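/- Let v be a non-constant word over A = {a,b}, let x be the last letter of v and y its complement. Then ψ(v) = ψ(v_+)·yx·ψ(v^-) = ψ(v^-)·xy·ψ(v_+). -/

import Mathlib

namespace Chri

/-- Length of the longest palindromic suffix of `w`. -/
def lpsLen (w : List Bool) : ℕ :=
  ((List.range (w.length + 1)).filter
    (fun l => w.drop (w.length - l) == (w.drop (w.length - l)).reverse)).foldr max 0

/-- Right palindromic closure: the shortest palindrome having `w` as a prefix. -/
def palClosure (w : List Bool) : List Bool :=
  w ++ (w.take (w.length - lpsLen w)).reverse

/-- The iterated palindromization map ψ. -/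
def psi (v : List Bool) : List Bool :=
  v.foldl (fun w x => palClosure (w ++ [x])) []

/-- Apply a substitution (morphism of the free monoid) letter by letter. -/
def applyM (f : Bool → List Bool) (w : List Bool) : List Bool := (w.map f).flatten

/-- μ_x : x ↦ x, y ↦ xy (a = false, b = true). -/
def muL (x : Bool) : List Bool → List Bool :=
  applyM (fun y => if y = x then [x] else [x, y])

/-- λ_a = μ_a; λ_b : a ↦ ab, b ↦ b. -/
def lamL : Bool → List Bool → List Bool
  | false => applyM (fun y => if y = false then [false] else [false, true])
  | true  => applyM (fun y => if y = true then [true] else [false, true])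

/-- μ_{v₁⋯v_n} = μ_{v₁} ∘ ⋯ ∘ μ_{v_n}. -/
def muW : List Bool → List Bool → List Bool
  | [], w => w
  | x :: v, w => muL x (muW v w)

/-- λ_{v₁⋯v_n} = λ_{v₁} ∘ ⋯ ∘ λ_{v_n}. -/
def lamW : List Bool → List Bool → List Bool
  | [], w => w
  | x :: v, w => lamL x (lamW v w)

/-- Christoffel words: the letters and the words aψ(v)b. -/
def IsChristoffel (w : List Bool) : Prop :=
  w = [false] ∨ w = [true] ∨ ∃ v, w = false :: (psi v ++ [true])

/-- A word is constant if it is a power of a single letter. -/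
def IsConstant (v : List Bool) : Prop := ∃ x n, v = List.replicate n x

/-- ₊v : the longest proper suffix of v immediately preceded by the complement of
the first letter of v. -/
def plusV (v : List Bool) : List Bool :=
  (v.dropWhile (fun y => y == v.headD false)).tail

/-- v₊ : the longest proper prefix of v immediately followed by the complement of
the last letter of v. -/
def vPlus (v : List Bool) : List Bool := (plusV v.reverse).reverse

/-- α₀: the length of the first maximal block of `v` (the index). -/
def blockLen (v : List Bool) : ℕ :=
  (v.takeWhile (fun y => y == v.headD false)).length

/-- The list of lengths of the maximal blocks of equal letters of `v`
(the integral representation (α₀, …, α_n)). -/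
def blockLens : List Bool → List ℕ
  | [] => []
  | [_] => [1]
  | x :: y :: v =>
    if x = y then
      match blockLens (y :: v) with
      | [] => [1]
      | n :: ns => (n + 1) :: ns
    else 1 :: blockLens (y :: v)

/-- ext(v) = number of maximal blocks of v. -/
def ext (v : List Bool) : ℕ := (blockLens v).length

/-- π(w): the minimal period of `w` (with π(ε) = 1). -/
noncomputable def minPeriod (w : List Bool) : ℕ :=
  sInf {p | 0 < p ∧ ∀ i, i + p < w.length → w.getD i false = w.getD (i + p) false}

/-- φ_k : a ↦ a^{k+1} b, b ↦ a^k b. -/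
def phi (k : ℕ) : List Bool → List Bool :=
  applyM (fun y => if y = false then List.replicate (k + 1) false ++ [true]
                   else List.replicate k false ++ [true])

/-- φ̂_k : a ↦ a b^k, b ↦ a b^{k+1}. -/
def phiHat (k : ℕ) : List Bool → List Bool :=
  applyM (fun y => if y = false then false :: List.replicate k true
                   else false :: List.replicate (k + 1) true)

attribute [local instance] Classical.propDecidable

/-- The derivative ∂w of a proper Christoffel word w = aψ(v)b of index k:
∂(ab) = a, and otherwise the preimage of w under φ_k (if v starts with a)
or φ̂_k (if v starts with b). -/
noncomputable def derivC (w : List Bool) : List Bool :=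
  if w = [false, true] then [false]
  else if h : ∃ v, v ≠ [] ∧ w = false :: (psi v ++ [true]) then
    if h.choose.headD false = false then Function.invFun (phi (blockLen h.choose)) w
    else Function.invFun (phiHat (blockLen h.choose)) w
  else w

/-- The depth of a Christoffel word: the least d with ∂^d w a single letter. -/
noncomputable def depth (w : List Bool) : ℕ :=
  sInf {d | derivC^[d] w = [false] ∨ derivC^[d] w = [true]}

/-- The height h(v): the least n ≥ 1 such that v_(n) is constant, where
v_(1) = v and v_(n+1) = ₊(v_(n)). -/
noncomputable def height (v : List Bool) : ℕ :=
  sInf {n | 0 < n ∧ IsConstant (plusV^[n - 1] v)}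

/-- Helper computing δ_i from (α_{i-1}, δ_{i-1}) along the remaining exponents. -/
def ruleAux : ℕ → ℕ → List ℕ → List ℕ
  | _, _, [] => []
  | pa, pd, a :: rest =>
    let d := if 1 < a then 1 else if 1 < pa then 0 else 1 - pd
    d :: ruleAux a d rest

/-- The sequence δ₀, δ₁, …, δ_n computed by the recursive rule (δ₀ = 1). -/
def ruleSeq : List ℕ → List ℕ
  | [] => []
  | a :: rest => 1 :: ruleAux a 1 rest

/-- δ(v) = Σ_{i=0}^n δ_i(v), where additionally δ_n(v) = 1; δ(ε) = 1. -/
def delta (v : List Bool) : ℕ := ((ruleSeq (blockLens v)).dropLast).sum + 1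

/-- |u₁|: length of the longest prefix x₀⋯x_i of u with i < n and α₀ = ⋯ = α_i = 1
(and 0 if α₀ > 1 or n = 0). -/
def u1len (u : List Bool) : ℕ :=
  min ((blockLens u).takeWhile (fun n => n == 1)).length ((blockLens u).length - 1)

/-- |u₂|: the symmetric notion for suffixes. -/
def u2len (u : List Bool) : ℕ := u1len u.reverse

/-- The sequence H: H(1) = 0, H(2n) = H(n), H(4n±1) = H(n)+1. -/
def H : ℕ → ℕ
  | 0 => 0
  | 1 => 0
  | n + 2 =>
    if (n + 2) % 2 = 0 then H ((n + 2) / 2)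
    else if (n + 2) % 4 = 1 then H ((n + 2) / 4) + 1
    else H ((n + 3) / 4) + 1
decreasing_by all_goals omega

/-- ⟨w⟩: the word w read as an integer in base 2 (a = 0, b = 1). -/
def wordVal (w : List Bool) : ℕ :=
  w.foldl (fun acc x => 2 * acc + (if x then 1 else 0)) 0

/-- Membership in X^*: w is a concatenation of words of X. -/
def InStar (X : Set (List Bool)) (w : List Bool) : Prop :=
  ∃ l : List (List Bool), (∀ u ∈ l, u ∈ X) ∧ w = l.flatten

/-- w ∈ x⁺. -/
def PowPos (x : Bool) (w : List Bool) : Prop := ∃ k, 0 < k ∧ w = List.replicate k x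

theorem le_foldr_max {l : List ℕ} {n : ℕ} (h : n ∈ l) : n ≤ l.foldr max 0 := by
  induction l with
  | nil => simp at h
  | cons a l ih =>
    rcases List.mem_cons.1 h with rfl | h
    · simp
    · simpa using Or.inr (ih h)

theorem foldr_max_mem_or_eq_zero (l : List ℕ) : l.foldr max 0 ∈ l ∨ l.foldr max 0 = 0 := by
  induction l with
  | nil => simp
  | cons a l ih =>
    rw [List.foldr_cons]
    rcases max_choice a (l.foldr max 0) with h | h <;> rw [h] <;> grind

theorem length_le_lpsLen {p s : List Bool} (hs : s.reverse = s) :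
    s.length ≤ lpsLen (p ++ s) := by
  apply le_foldr_max
  simp [hs]

theorem lpsLen_spec (w : List Bool) :
    ∃ p s, w = p ++ s ∧ s.reverse = s ∧ s.length = lpsLen w := by
  refine ⟨w.take (w.length - lpsLen w), w.drop (w.length - lpsLen w), by simp, ?_⟩
  have h := foldr_max_mem_or_eq_zero ((List.range (w.length + 1)).filter
    (fun l => w.drop (w.length - l) == (w.drop (w.length - l)).reverse))
  change lpsLen w ∈ _ ∨ lpsLen w = 0 at h
  rcases h with h | h
  · simp only [List.mem_filter, List.mem_range, beq_iff_eq] at h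
    refine ⟨h.2.symm, ?_⟩
    rw [List.length_drop]
    omega
  · simp [h]

theorem palClosure_append {p s : List Bool} (hs : s.length = lpsLen (p ++ s)) :
    palClosure (p ++ s) = p ++ s ++ p.reverse := by
  simp [palClosure, ← hs]

/-- The closure is computed from any palindromic suffix that is at least as long as all others. -/
theorem palClosure_eq_of_maximal {p s : List Bool} (hs : s.reverse = s)
    (hmax : ∀ q t, p ++ s = q ++ t → t.reverse = t → t.length ≤ s.length) :
    palClosure (p ++ s) = p ++ s ++ p.reverse := by
  apply palClosure_append
  obtain ⟨q, t, h, ht, hl⟩ := lpsLen_spec (p ++ s)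
  exact le_antisymm (length_le_lpsLen hs) (hl ▸ hmax q t h ht)

theorem prefix_palClosure (w : List Bool) : w <+: palClosure w :=
  List.prefix_append _ _

theorem reverse_palClosure (w : List Bool) : (palClosure w).reverse = palClosure w := by
  obtain ⟨p, s, rfl, hs, hl⟩ := lpsLen_spec w
  rw [palClosure_append hl]
  simp [hs]

/-- The closure of `w` is the only palindrome among its prefixes that extend `w`. -/
theorem eq_palClosure_of_prefix {w q : List Bool} (hq : q.reverse = q) (hw : w <+: q)
    (hp : q <+: palClosure w) : q = palClosure w := by
  apply hp.eq_of_length_le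
  obtain ⟨t, rfl⟩ := hw
  obtain ⟨p, s, h, hs, hl⟩ := lpsLen_spec w
  have hlen : (palClosure w).length = w.length + p.length := by
    conv_lhs => rw [h]
    rw [palClosure_append (h ▸ hl), h]
    simp [add_assoc]
  have htp : t.length ≤ w.length := by
    have h1 := hp.length_le
    have h2 := congrArg List.length h
    simp only [List.length_append] at h1 h2
    omega
  rw [List.reverse_append] at hq
  obtain ⟨u, hu⟩ : t.reverse <+: w :=
    List.prefix_of_prefix_length_le ⟨w.reverse, hq⟩ (List.prefix_append _ _)
      (by simpa using htp)
  have hupal : u.reverse = u := by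
    rw [← hu] at hq
    simpa using hq
  have h3 := length_le_lpsLen (p := t.reverse) hupal
  rw [hu, ← hl] at h3
  have h4 := congrArg List.length (h.symm.trans hu.symm)
  simp only [List.length_append, List.length_reverse] at h4 ⊢
  omega

theorem psi_concat (w : List Bool) (x : Bool) : psi (w ++ [x]) = palClosure (psi w ++ [x]) := by
  simp [psi]

theorem reverse_psi (w : List Bool) : (psi w).reverse = psi w := by
  induction w using List.reverseRecOn with
  | nil => rfl
  | append_singleton w x _ => rw [psi_concat, reverse_palClosure]

theorem psi_concat_prefix (w : List Bool) (x : Bool) : psi w ++ [x] <+: psi (w ++ [x]) :=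
  psi_concat w x ▸ prefix_palClosure _

theorem psi_prefix_psi_append (u w : List Bool) : psi u <+: psi (u ++ w) := by
  induction w using List.reverseRecOn with
  | nil => simp
  | append_singleton w x ih =>
    rw [← List.append_assoc]
    exact ih.trans ((List.prefix_append _ _).trans (psi_concat_prefix _ x))

theorem psi_prefix_psi {u w : List Bool} (h : u <+: w) : psi u <+: psi w := by
  obtain ⟨t, rfl⟩ := h
  exact psi_prefix_psi_append u t

/-- The palindromic prefixes of `psi w` are the images of the prefixes of `w`. -/
theorem exists_prefix_eq_psi {w q : List Bool} (hq : q.reverse = q) (h : q <+: psi w) :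
    ∃ u, u <+: w ∧ q = psi u := by
  induction w using List.reverseRecOn with
  | nil => exact ⟨[], by simp, List.prefix_nil.1 h⟩
  | append_singleton w x ih =>
    by_cases hl : q.length ≤ (psi w).length
    · obtain ⟨u, hu, rfl⟩ :=
        ih (List.prefix_of_prefix_length_le h (psi_prefix_psi_append w [x]) hl)
      exact ⟨u, hu.trans (List.prefix_append _ _), rfl⟩
    · refine ⟨w ++ [x], List.prefix_rfl, ?_⟩
      have hw : psi w ++ [x] <+: q :=
        List.prefix_of_prefix_length_le (psi_concat_prefix w x) h (by simp; omega)
      rw [psi_concat] at h ⊢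
      exact eq_palClosure_of_prefix hq hw h

/-- A palindromic suffix of `psi w ++ [x]` of length at least two is
`x · psi u · x` for some prefix `u` of `w` followed by `x`. -/
theorem palindromic_suffix_psi_concat {w q t : List Bool} {x : Bool}
    (h : psi w ++ [x] = q ++ t) (ht : t.reverse = t) :
    t.length ≤ 1 ∨ ∃ u, u ++ [x] <+: w ∧ t = x :: (psi u ++ [x]) := by
  by_cases hl : t.length ≤ 1
  · exact Or.inl hl
  right
  obtain rfl | ⟨s, z, rfl⟩ := List.eq_nil_or_concat' t
  · simp at hl
  rw [← List.append_assoc] at h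
  obtain ⟨hw, hz⟩ := List.append_inj' h rfl
  obtain rfl : x = z := by simpa using hz
  cases s with
  | nil => simp at hl
  | cons c m =>
    simp only [List.reverse_append, List.reverse_cons, List.reverse_nil, List.nil_append,
      List.cons_append, List.cons.injEq] at ht
    obtain ⟨rfl, ht⟩ := ht
    have hm : m.reverse = m := (List.append_inj' ht rfl).1
    have hpre : m ++ [x] <+: psi w := by
      rw [← reverse_psi, hw]
      exact ⟨q.reverse, by simp [hm]⟩
    obtain ⟨u, ⟨v, rfl⟩, rfl⟩ :=
      exists_prefix_eq_psi hm ((List.prefix_append _ _).trans hpre)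
    refine ⟨u, ?_, rfl⟩
    cases v with
    | nil => simpa using hpre.length_le
    | cons z v =>
      have h1 : psi u ++ [z] <+: psi (u ++ z :: v) :=
        (psi_concat_prefix u z).trans (psi_prefix_psi ⟨v, by simp⟩)
      have h2 := (List.prefix_of_prefix_length_le h1 hpre (by simp)).eq_of_length (by simp)
      obtain rfl : z = x := by simpa using h2
      exact ⟨v, by simp⟩

theorem psi_concat_of_notMem {w : List Bool} {x : Bool} (hx : x ∉ w) :
    psi (w ++ [x]) = psi w ++ [x] ++ psi w := by
  rw [psi_concat, palClosure_eq_of_maximal (by simp), reverse_psi]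
  intro q t h ht
  rcases palindromic_suffix_psi_concat h ht with h1 | ⟨u, hu, -⟩
  · simpa using h1
  · exact absurd (hu.subset (by simp)) hx

theorem psi_concat_of_last_occurrence {u v r : List Bool} {x : Bool} (hv : x ∉ v)
    (hr : psi (u ++ x :: v) = psi u ++ x :: r) :
    psi (u ++ x :: v ++ [x]) = psi (u ++ x :: v) ++ x :: r := by
  have hrev : psi (u ++ x :: v) = r.reverse ++ (x :: psi u) := by
    rw [← reverse_psi, hr]
    simp [reverse_psi]
  have hsplit : psi (u ++ x :: v) ++ [x] = r.reverse ++ (x :: (psi u ++ [x])) := by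
    simp [hrev]
  rw [psi_concat, hsplit, palClosure_eq_of_maximal (by simp [reverse_psi]), ← hsplit]
  · simp
  · intro q t h ht
    rw [← hsplit] at h
    rcases palindromic_suffix_psi_concat h ht with h1 | ⟨u', hu', rfl⟩
    · simp; omega
    · have hle : u'.length ≤ u.length := by
        by_contra! hlt
        obtain ⟨z, hz⟩ := hu'
        obtain ⟨c, rfl, hc⟩ : ∃ c, u' = u ++ x :: c ∧ x :: c ++ x :: z = x :: v := by
          rw [List.append_assoc] at hz
          rcases List.append_eq_append_iff.1 hz with ⟨c, rfl, hc⟩ | ⟨c, rfl, hc⟩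
          · simp at hlt
          · cases c with
            | nil => simp at hlt
            | cons d c =>
              simp only [List.cons_append, List.cons.injEq] at hc
              exact ⟨c, by rw [hc.1], by simpa using hc.2.symm⟩
        simp only [List.cons_append, List.cons.injEq, true_and] at hc
        exact hv (hc ▸ by simp)
      have hpre : u' <+: u :=
        List.prefix_of_prefix_length_le ((List.prefix_append _ _).trans hu')
          (List.prefix_append _ _) hle
      simpa using (psi_prefix_psi hpre).length_le

theorem psi_replicate_succ (n : ℕ) (x : Bool) :
    psi (List.replicate (n + 1) x) = psi (List.replicate n x) ++ [x] := by
  induction n with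
  | zero => simpa [psi] using psi_concat_of_notMem (w := []) (x := x) (by simp)
  | succ n ih =>
    rw [List.replicate_succ'] at ih
    rw [List.replicate_succ', List.replicate_succ']
    exact psi_concat_of_last_occurrence (by simp) ih

theorem psi_replicate (n : ℕ) (x : Bool) : psi (List.replicate n x) = List.replicate n x := by
  induction n with
  | zero => rfl
  | succ n ih => rw [psi_replicate_succ, ih, List.replicate_succ']

theorem eq_replicate_not_of_notMem {l : List Bool} {x : Bool} (hx : x ∉ l) :
    l = List.replicate l.length (!x) :=
  List.eq_replicate_iff.2 ⟨rfl, fun b hb => by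
    rcases Bool.eq_or_eq_not b x with rfl | h
    · exact absurd hb hx
    · exact h⟩

theorem exists_last_occurrence {l : List Bool} {x : Bool} (hx : x ∈ l) :
    ∃ p j, l = p ++ x :: List.replicate j (!x) := by
  obtain ⟨s, t, h, ht⟩ := List.eq_append_cons_of_mem (List.mem_reverse.2 hx)
  refine ⟨t.reverse, s.length, ?_⟩
  rw [← List.reverse_reverse l, h]
  conv_lhs => rw [eq_replicate_not_of_notMem ht]
  simp

/-- The factorization of `psi` at the last occurrence of the complement of the last letter. -/
theorem psi_append_replicate_succ (p : List Bool) (x : Bool) (k : ℕ) :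
    psi (p ++ (!x) :: List.replicate (k + 1) x) =
      psi (p ++ (!x) :: List.replicate k x) ++ x :: (!x) :: psi p := by
  induction hn : p.length using Nat.strong_induction_on generalizing p x k with
  | _ n ihp =>
  induction k with
  | zero =>
    have hcat : p ++ (!x) :: List.replicate (0 + 1) x = p ++ [!x] ++ [x] := by simp
    rw [hcat]
    by_cases hx : x ∈ p
    · obtain ⟨q, j, rfl⟩ := exists_last_occurrence hx
      have h := ihp q.length (by simp at hn; omega) q (!x) j rfl
      simp only [Bool.not_not] at h
      have h' := congrArg List.reverse h
      rw [reverse_psi, List.reverse_append] at h'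
      simp only [List.reverse_cons, reverse_psi, List.append_assoc, List.cons_append,
        List.nil_append] at h'
      have := psi_concat_of_last_occurrence (by simp) h'
      simpa [List.replicate_succ'] using this
    · have hp := eq_replicate_not_of_notMem hx
      have hrep : p ++ [!x] = List.replicate (p.length + 1) (!x) := by
        rw [List.replicate_succ', ← hp]
      rw [psi_concat_of_notMem (by simpa using hx)]
      have hpsi : psi (p ++ [!x]) = (!x) :: psi p := by
        rw [hrep, psi_replicate, List.replicate_succ, ← psi_replicate, ← hp]
      rw [List.replicate_zero, List.append_assoc]
      congr 1
      rw [hpsi]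
      rfl
  | succ k ih =>
    have h := psi_concat_of_last_occurrence (u := p ++ (!x) :: List.replicate k x) (v := [])
      (r := (!x) :: psi p) (x := x) (by simp)
    have hcat : ∀ m, p ++ (!x) :: List.replicate (m + 1) x =
        p ++ (!x) :: List.replicate m x ++ [x] := by simp [List.replicate_succ']
    rw [hcat (k + 1), hcat k]
    exact h (hcat k ▸ ih)

theorem vPlus_append_replicate (p : List Bool) (x : Bool) (k : ℕ) :
    vPlus (p ++ (!x) :: List.replicate (k + 1) x) = p := by
  have h : (p ++ (!x) :: List.replicate (k + 1) x).reverse =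
      List.replicate (k + 1) x ++ (!x) :: p.reverse := by simp
  rw [vPlus, h, plusV, show (List.replicate (k + 1) x ++ (!x) :: p.reverse).headD false = x by
    simp [List.replicate_succ],
    List.dropWhile_append_of_pos (by simp)]
  simp

/-- ψ(v) = ψ(v₊)·yx·ψ(v⁻) = ψ(v⁻)·xy·ψ(v₊) for v non-constant
with last letter x and y its complement. -/
theorem psi_two_factorizations (v : List Bool) (hv : ¬ IsConstant v) (x : Bool)
    (hx : v.getLast? = some x) :
    psi v = psi (vPlus v) ++ [!x, x] ++ psi v.dropLast ∧
    psi v = psi v.dropLast ++ [x, !x] ++ psi (vPlus v) := by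
  have hmem : (!x) ∈ v := by
    by_contra h
    exact hv ⟨x, v.length, by simpa using eq_replicate_not_of_notMem h⟩
  obtain ⟨p, j, rfl⟩ := exists_last_occurrence hmem
  rw [Bool.not_not] at hx ⊢
  cases j with
  | zero => simp at hx
  | succ k =>
    have hdrop : (p ++ (!x) :: List.replicate (k + 1) x).dropLast =
        p ++ (!x) :: List.replicate k x := by
      have : p ++ (!x) :: List.replicate (k + 1) x =
          p ++ (!x) :: List.replicate k x ++ [x] := by simp [List.replicate_succ']
      rw [this, List.dropLast_concat]
    rw [hdrop, vPlus_append_replicate]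
    have h := psi_append_replicate_succ p x k
    refine ⟨?_, by simpa using h⟩
    rw [← reverse_psi, h]
    simp [reverse_psi]

end Chri
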